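/- Suppose α ≥ 1. Then there is a constant C_α depending only on α such that for all integers n ≥ 2, Σ_{λ partition of n} π_α(λ)·Σ_{ρ partition of n} M_α(λ,ρ)·|W_α(ρ) − W_α(λ)|³ ≤ C_α·n^{−3/2}. -/

import Mathlib

open Finset

namespace JackTest

def colLen {n : ℕ} (lam : n.Partition) (j : ℕ) : ℕ :=
  (lam.parts.filter (fun p => j < p)).card

def rowLen {n : ℕ} (lam : n.Partition) (i : ℕ) : ℕ :=
  ((Finset.range n).filter (fun j => i < colLen lam j)).card

def cells {n : ℕ} (lam : n.Partition) : Finset (ℕ × ℕ) :=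
  (Finset.range n ×ˢ Finset.range n).filter (fun s => s.2 < rowLen lam s.1)

def arm {n : ℕ} (lam : n.Partition) (s : ℕ × ℕ) : ℕ := rowLen lam s.1 - (s.2 + 1)

def leg {n : ℕ} (lam : n.Partition) (s : ℕ × ℕ) : ℕ := colLen lam s.2 - (s.1 + 1)

noncomputable def cLow (α : ℝ) {n : ℕ} (lam : n.Partition) : ℝ :=
  ∏ s ∈ cells lam, (α * arm lam s + leg lam s + 1)

noncomputable def cUp (α : ℝ) {n : ℕ} (lam : n.Partition) : ℝ :=
  ∏ s ∈ cells lam, (α * arm lam s + leg lam s + α)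

noncomputable def jackP (α : ℝ) {n : ℕ} (lam : n.Partition) : ℝ :=
  α ^ n * (n.factorial) / (cLow α lam * cUp α lam)

def nStat {n : ℕ} (lam : n.Partition) : ℕ := ∑ i ∈ Finset.range n, i * rowLen lam i

def nStatConj {n : ℕ} (lam : n.Partition) : ℕ := ∑ j ∈ Finset.range n, j * colLen lam j

noncomputable def W (α : ℝ) {n : ℕ} (lam : n.Partition) : ℝ :=
  (α * nStatConj lam - nStat lam) / Real.sqrt (α * n.choose 2)

noncomputable def Phi (x : ℝ) : ℝ :=
  (Real.sqrt (2 * Real.pi))⁻¹ * ∫ t in Set.Iic x, Real.exp (-t ^ 2 / 2)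

/-- `ψ'_{λ/τ}(α)`: zero unless `τ ⊆ λ` (the sizes `|λ| = |τ| + 1` are enforced by the types);
otherwise the product over boxes in the columns of `λ` meeting `λ - τ` but not in the rows
of `λ` meeting `λ - τ`. -/
noncomputable def psi' (α : ℝ) {n : ℕ} (lam : n.Partition) (tau : (n - 1).Partition) : ℝ :=
  if cells tau ⊆ cells lam then
    ∏ s ∈ ((cells lam).filter fun s => ∃ t ∈ cells lam \ cells tau, s.2 = t.2) \
        ((cells lam).filter fun s => ∃ t ∈ cells lam \ cells tau, s.1 = t.1),
      (α * arm lam s + leg lam s + 1) / (α * arm lam s + leg lam s + α) *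
        ((α * arm tau s + leg tau s + α) / (α * arm tau s + leg tau s + 1))
  else 0

/-- The Markov chain `M_α` on partitions of `n`. -/
noncomputable def M (α : ℝ) {n : ℕ} (lam rho : n.Partition) : ℝ :=
  cUp α lam / (α * n * cLow α rho) *
    ∑ tau : (n - 1).Partition, psi' α lam tau * psi' α rho tau * cLow α tau / cUp α tau


/-- The divided difference of `f` at the nodes `v i`, `i ∈ s`. -/
noncomputable def dividedDiff (s : Finset ℕ) (v : ℕ → ℝ) (f : ℝ → ℝ) : ℝ :=
  ∑ i ∈ s, f (v i) / ∏ j ∈ s.erase i, (v i - v j)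

lemma dividedDiff_insert {s : Finset ℕ} {v : ℕ → ℝ} {a : ℕ} (ha : a ∉ s)
    (hv : Set.InjOn v (insert a s : Finset ℕ)) (f : ℝ → ℝ) :
    dividedDiff (insert a s) v (fun z => (z - v a) * f z) = dividedDiff s v f := by
  unfold dividedDiff
  rw [Finset.sum_insert ha]
  simp only [sub_self, zero_mul, zero_div, zero_add]
  refine Finset.sum_congr rfl fun i hi => ?_
  have hia : a ≠ i := fun h => ha (h ▸ hi)
  have hne : v i - v a ≠ 0 := by
    refine sub_ne_zero.2 fun h => hia ?_
    exact (hv (by simp [hi]) (by simp) h).symm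
  rw [Finset.erase_insert_of_ne hia, Finset.prod_insert (by simp [ha])]
  rw [mul_div_mul_left _ _ hne]

lemma dividedDiff_add (s : Finset ℕ) (v : ℕ → ℝ) (f g : ℝ → ℝ) :
    dividedDiff s v (fun z => f z + g z) = dividedDiff s v f + dividedDiff s v g := by
  simp [dividedDiff, add_div, Finset.sum_add_distrib]

lemma dividedDiff_const_mul (s : Finset ℕ) (v : ℕ → ℝ) (c : ℝ) (f : ℝ → ℝ) :
    dividedDiff s v (fun z => c * f z) = c * dividedDiff s v f := by
  simp [dividedDiff, mul_div_assoc, Finset.mul_sum]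

lemma dividedDiff_mul_id {s : Finset ℕ} {v : ℕ → ℝ} {a : ℕ} (ha : a ∉ s)
    (hv : Set.InjOn v (insert a s : Finset ℕ)) (f : ℝ → ℝ) :
    dividedDiff (insert a s) v (fun z => z * f z) =
      v a * dividedDiff (insert a s) v f + dividedDiff s v f := by
  rw [← dividedDiff_insert ha hv, ← dividedDiff_const_mul, ← dividedDiff_add]
  congr 1; funext z; ring

lemma dividedDiff_mul_sub {s : Finset ℕ} {v : ℕ → ℝ} {a : ℕ} (ha : a ∉ s)
    (hv : Set.InjOn v (insert a s : Finset ℕ)) (f : ℝ → ℝ) (b : ℝ) :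
    dividedDiff (insert a s) v (fun z => (z - b) * f z) =
      dividedDiff s v f + (v a - b) * dividedDiff (insert a s) v f := by
  rw [← dividedDiff_insert ha hv, ← dividedDiff_const_mul, ← dividedDiff_add]
  congr 1; funext z; ring

lemma dividedDiff_prod_eq_zero {s t : Finset ℕ} {v w : ℕ → ℝ} (hv : Set.InjOn v s)
    (h : t.card + 1 < s.card) : dividedDiff s v (fun z => ∏ i ∈ t, (z - w i)) = 0 := by
  have hdeg : (∏ i ∈ t, (Polynomial.X - Polynomial.C (w i))).natDegree = t.card := by
    simp
  have hlt : (∏ i ∈ t, (Polynomial.X - Polynomial.C (w i))).degree < (s.card : WithBot ℕ) :=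
    lt_of_le_of_lt Polynomial.degree_le_natDegree
      (by rw [hdeg]; exact_mod_cast (by omega : t.card < s.card))
  have := Lagrange.coeff_eq_sum hv hlt
  rw [Polynomial.coeff_eq_zero_of_natDegree_lt (by rw [hdeg]; omega)] at this
  rw [dividedDiff, this]
  simp [Polynomial.eval_prod]

lemma dividedDiff_prod_eq_one {s t : Finset ℕ} {v w : ℕ → ℝ} (hv : Set.InjOn v s)
    (h : t.card + 1 = s.card) : dividedDiff s v (fun z => ∏ i ∈ t, (z - w i)) = 1 := by
  have hdeg : (∏ i ∈ t, (Polynomial.X - Polynomial.C (w i))).natDegree = t.card := by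
    simp
  have hlt : (∏ i ∈ t, (Polynomial.X - Polynomial.C (w i))).degree < (s.card : WithBot ℕ) :=
    lt_of_le_of_lt Polynomial.degree_le_natDegree
      (by rw [hdeg]; exact_mod_cast (by omega : t.card < s.card))
  have hmon : (∏ i ∈ t, (Polynomial.X - Polynomial.C (w i))).Monic :=
    Polynomial.monic_prod_of_monic _ _ fun i _ => Polynomial.monic_X_sub_C _
  have := Lagrange.coeff_eq_sum hv hlt
  rw [show s.card - 1 = (∏ i ∈ t, (Polynomial.X - Polynomial.C (w i))).natDegree by
    rw [hdeg]; omega, hmon.coeff_natDegree] at this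
  rw [dividedDiff, this]
  simp [Polynomial.eval_prod]

/-- The first moments of `∏ (z - v i + 1) / ∏ (z - v i)`, by Newton's identities. -/
lemma dividedDiff_moments {e : ℕ} {v : ℕ → ℝ} (s : Finset ℕ) (he : e ∉ s)
    (hv : Set.InjOn v (insert e s : Finset ℕ)) (p : ℕ → ℝ)
    (hp : ∀ j, p j = v e ^ j + ∑ i ∈ s, (v i ^ j - (v i - 1) ^ j))
    (D : ℕ → ℝ)
    (hD : ∀ k, D k = dividedDiff (insert e s) v (fun z => z ^ k * ∏ i ∈ s, (z - (v i - 1)))) :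
    D 0 = 1 ∧ D 1 = p 1 ∧ D 2 = (p 1 ^ 2 + p 2) / 2 ∧
      D 3 = (p 1 ^ 3 + 3 * p 1 * p 2 + 2 * p 3) / 6 ∧
      D 4 = (p 1 ^ 4 + 6 * p 1 ^ 2 * p 2 + 3 * p 2 ^ 2 + 8 * p 1 * p 3 + 6 * p 4) / 24 := by
  induction s using Finset.induction_on generalizing p D with
  | empty =>
    have h1 : ∀ k, D k = v e ^ k := fun k => by simp [hD, dividedDiff]
    have h2 : ∀ k, p k = v e ^ k := fun k => by simp [hp]
    simp only [h1, h2, pow_zero, pow_one, true_and]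
    refine ⟨by ring, by ring, by ring⟩
  | insert a s ha ih =>
    have hes : e ∉ s := fun h => he (by simp [h])
    have hea : e ≠ a := fun h => he (by simp [h])
    have hcomm : insert e (insert a s) = insert a (insert e s) := Finset.insert_comm _ _ _
    rw [hcomm] at hv hD
    have ha' : a ∉ insert e s := by simp [ha, hea.symm]
    obtain ⟨q, hq⟩ : ∃ q : ℕ → ℝ, ∀ j, q j = v e ^ j + ∑ i ∈ s, (v i ^ j - (v i - 1) ^ j) :=
      ⟨_, fun _ => rfl⟩
    obtain ⟨D', hD'⟩ : ∃ D' : ℕ → ℝ, ∀ k, D' k =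
        dividedDiff (insert e s) v (fun z => z ^ k * ∏ i ∈ s, (z - (v i - 1))) :=
      ⟨_, fun _ => rfl⟩
    obtain ⟨U, hU⟩ : ∃ U : ℕ → ℝ, ∀ k, U k =
        dividedDiff (insert a (insert e s)) v (fun z => z ^ k * ∏ i ∈ s, (z - (v i - 1))) :=
      ⟨_, fun _ => rfl⟩
    obtain ⟨h0, h1, h2, h3, h4⟩ := ih hes
      (hv.mono (by intro x hx; simp only [Finset.coe_insert] at hx ⊢; right; exact hx)) q hq D' hD'
    have hpq : ∀ j, p j = q j + (v a ^ j - (v a - 1) ^ j) := fun j => by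
      rw [hp, Finset.sum_insert ha, hq]; ring
    have hU0 : U 0 = 0 := by
      simp only [hU, pow_zero, one_mul]
      refine dividedDiff_prod_eq_zero hv ?_
      rw [Finset.card_insert_of_notMem ha', Finset.card_insert_of_notMem hes]
      omega
    have hUs : ∀ k, U (k + 1) = v a * U k + D' k := fun k => by
      simp only [hU, hD']
      rw [← dividedDiff_mul_id ha' hv]
      congr 1; funext z; ring
    have hDs : ∀ k, D k = D' k + U k := fun k => by
      simp only [hD, hU, hD']
      rw [show (fun z => z ^ k * ∏ i ∈ insert a s, (z - (v i - 1))) =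
        fun z => (z - (v a - 1)) * (z ^ k * ∏ i ∈ s, (z - (v i - 1))) by
          funext z; rw [Finset.prod_insert ha]; ring]
      rw [dividedDiff_mul_sub ha' hv]; ring
    have hU1 := hUs 0
    have hU2 := hUs 1
    have hU3 := hUs 2
    have hU4 := hUs 3
    norm_num only at hU1 hU2 hU3 hU4
    simp only [hDs, hpq, hU4, hU3, hU2, hU1, hU0, h0, h1, h2, h3, h4]
    refine ⟨by ring, by ring, by ring, by ring, by ring⟩

/-- The first moments of `∏ (z - v i) / ∏ (z - (v i - 1))`. -/
lemma dividedDiff_comoments {v : ℕ → ℝ} (s : Finset ℕ) (hv : Set.InjOn v s) :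
    dividedDiff s (fun i => v i - 1) (fun z => ∏ i ∈ s, (z - v i)) = -s.card ∧
    dividedDiff s (fun i => v i - 1) (fun z => z * ∏ i ∈ s, (z - v i)) =
      -∑ i ∈ s, (v i - 1) + s.card * (s.card - 1) / 2 := by
  induction s using Finset.induction_on with
  | empty => simp [dividedDiff]
  | insert a s ha ih =>
    obtain ⟨h0, h1⟩ := ih (hv.mono (by simp))
    have hv' : Set.InjOn (fun i => v i - 1) (insert a s : Finset ℕ) :=
      fun x hx y hy h => hv hx hy (sub_left_injective h)
    set P : ℝ → ℝ := fun z => ∏ i ∈ s, (z - v i) with hP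
    have hU0 : dividedDiff (insert a s) (fun i => v i - 1) P = 1 :=
      dividedDiff_prod_eq_one hv' (by rw [Finset.card_insert_of_notMem ha])
    have hU1 := dividedDiff_mul_id ha hv' P
    have e0 := dividedDiff_mul_sub ha hv' P (v a)
    have e1 := dividedDiff_mul_sub ha hv' (fun z => z * P z) (v a)
    rw [show (fun z => ∏ i ∈ insert a s, (z - v i)) = fun z => (z - v a) * P z by
        funext z; rw [Finset.prod_insert ha],
      show (fun z => z * ∏ i ∈ insert a s, (z - v i)) = fun z => (z - v a) * (z * P z) by
        funext z; rw [Finset.prod_insert ha]; ring, e0, e1, hU1, hU0, h0, h1,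
      Finset.card_insert_of_notMem ha, Finset.sum_insert ha]
    push_cast
    constructor <;> ring

lemma colLen_antitone {n : ℕ} (lam : n.Partition) : Antitone (colLen lam) := fun _ _ h =>
  Multiset.card_le_card (Multiset.monotone_filter_right _ fun _ hp => lt_of_le_of_lt h hp)

lemma colLen_eq_zero {n : ℕ} (lam : n.Partition) {j : ℕ} (h : n ≤ j) : colLen lam j = 0 := by
  rw [colLen, Multiset.card_eq_zero, Multiset.filter_eq_nil]
  intro p hp
  have := lam.le_of_mem_parts hp
  omega

lemma sum_card_filter_lt {n : ℕ} (s : Multiset ℕ) (hs : ∀ p ∈ s, p ≤ n) :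
    ∑ j ∈ Finset.range n, (s.filter fun p => j < p).card = s.sum := by
  induction s using Multiset.induction_on with
  | empty => simp
  | cons a s ih =>
    have ha : a ≤ n := hs a (by simp)
    have h1 : ∑ j ∈ Finset.range n, (if j < a then 1 else 0) = a := by
      rw [Finset.sum_boole, show (Finset.range n).filter (fun j => j < a) = Finset.range a by
        ext j; simp; omega]
      simp
    rw [Multiset.sum_cons, ← ih fun p hp => hs p (by simp [hp])]
    nth_rewrite 2 [← h1]
    rw [← Finset.sum_add_distrib]
    refine Finset.sum_congr rfl fun j _ => ?_
    by_cases h : j < a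
    · simp [h, add_comm]
    · simp [h]

lemma sum_colLen {n : ℕ} (lam : n.Partition) : ∑ j ∈ Finset.range n, colLen lam j = n :=
  (sum_card_filter_lt _ fun _ hp => lam.le_of_mem_parts hp).trans lam.parts_sum

lemma lt_card_filter_iff {n : ℕ} {c : ℕ → ℕ} (hc : Antitone c) (h0 : ∀ j, n ≤ j → c j = 0)
    (i j : ℕ) : j < ((Finset.range n).filter fun j => i < c j).card ↔ i < c j := by
  constructor
  · intro h
    by_contra hij
    have : (Finset.range n).filter (fun j => i < c j) ⊆ Finset.range j := by
      intro k hk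
      simp only [Finset.mem_filter, Finset.mem_range] at hk ⊢
      by_contra hkj
      have := hc (not_lt.1 hkj)
      omega
    have := Finset.card_le_card this
    rw [Finset.card_range] at this
    omega
  · intro h
    have : Finset.range (j + 1) ⊆ (Finset.range n).filter (fun j => i < c j) := by
      intro k hk
      simp only [Finset.mem_filter, Finset.mem_range] at hk ⊢
      have h1 := hc (Nat.lt_succ_iff.1 hk)
      refine ⟨?_, by omega⟩
      by_contra hkn
      have := h0 k (not_lt.1 hkn)
      omega
    have := Finset.card_le_card this
    rw [Finset.card_range] at this
    omega

lemma lt_rowLen_iff {n : ℕ} (lam : n.Partition) (i j : ℕ) :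
    j < rowLen lam i ↔ i < colLen lam j :=
  lt_card_filter_iff (colLen_antitone lam) (fun _ => colLen_eq_zero lam) i j

lemma rowLen_antitone {n : ℕ} (lam : n.Partition) : Antitone (rowLen lam) := by
  intro i k h
  by_contra hlt
  have h1 := (lt_rowLen_iff lam k _).1 (not_le.1 hlt)
  have h2 := (lt_rowLen_iff lam i (rowLen lam i)).not.1 (lt_irrefl _)
  omega

lemma colLen_le {n : ℕ} (lam : n.Partition) (j : ℕ) : colLen lam j ≤ n := by
  refine (colLen_antitone lam (Nat.zero_le j)).trans ?_
  rcases Nat.eq_zero_or_pos n with h | h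
  · exact (colLen_eq_zero lam (by omega)).le.trans (Nat.zero_le _)
  · calc colLen lam 0 ≤ ∑ j ∈ Finset.range n, colLen lam j :=
          Finset.single_le_sum (f := colLen lam) (fun _ _ => Nat.zero_le _) (by simpa using h)
      _ = n := sum_colLen lam

lemma sum_rowLen {n : ℕ} (lam : n.Partition) : ∑ i ∈ Finset.range n, rowLen lam i = n := by
  refine Eq.trans ?_ (sum_colLen lam)
  simp only [rowLen, Finset.card_filter]
  rw [Finset.sum_comm]
  refine Finset.sum_congr rfl fun j _ => ?_
  rw [Finset.sum_boole, show (Finset.range n).filter (fun i => i < colLen lam j) =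
    Finset.range (colLen lam j) by ext i; have := colLen_le lam j; simp; omega]
  simp

lemma rowLen_eq_zero {n : ℕ} (lam : n.Partition) {i : ℕ} (h : n ≤ i) : rowLen lam i = 0 := by
  by_contra h0
  have := (lt_rowLen_iff lam i 0).1 (Nat.pos_of_ne_zero h0)
  have := colLen_le lam 0
  omega

lemma colLen_eq_of_rowLen_eq {m n : ℕ} (lam : m.Partition) (mu : n.Partition)
    (h : rowLen lam = rowLen mu) : colLen lam = colLen mu := by
  funext j
  have : ∀ i, i < colLen lam j ↔ i < colLen mu j := fun i => by
    rw [← lt_rowLen_iff, ← lt_rowLen_iff, h]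
  have h1 := this (colLen lam j)
  have h2 := this (colLen mu j)
  omega

lemma count_parts {n : ℕ} (lam : n.Partition) (j : ℕ) :
    lam.parts.count (j + 1) = colLen lam j - colLen lam (j + 1) := by
  suffices ∀ s : Multiset ℕ, s.count (j + 1) + (s.filter fun p => j + 1 < p).card =
      (s.filter fun p => j < p).card by
    have := this lam.parts
    unfold colLen
    omega
  intro s
  induction s using Multiset.induction_on with
  | empty => simp
  | cons a s ih =>
    rcases lt_trichotomy a (j + 1) with h | h | h
    · rw [Multiset.count_cons_of_ne (by omega), Multiset.filter_cons_of_neg _ (by omega),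
        Multiset.filter_cons_of_neg _ (by omega), ih]
    · rw [h, Multiset.count_cons_self, Multiset.filter_cons_of_neg _ (by omega),
        Multiset.filter_cons_of_pos _ (by omega), Multiset.card_cons, ← ih]
      omega
    · rw [Multiset.count_cons_of_ne (by omega), Multiset.filter_cons_of_pos _ (by omega),
        Multiset.filter_cons_of_pos _ (by omega), Multiset.card_cons, Multiset.card_cons, ← ih]
      omega

lemma rowLen_injective {n : ℕ} : Function.Injective (rowLen : n.Partition → ℕ → ℕ) := by
  intro lam mu h
  have hc := colLen_eq_of_rowLen_eq lam mu h
  refine Nat.Partition.ext (Multiset.ext' fun p => ?_)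
  cases p with
  | zero =>
    rw [Multiset.count_eq_zero_of_notMem fun h => (lam.parts_pos h).ne rfl,
      Multiset.count_eq_zero_of_notMem fun h => (mu.parts_pos h).ne rfl]
  | succ j => rw [count_parts, count_parts, hc]

lemma exists_rowLen_eq {n : ℕ} {f : ℕ → ℕ} (hf : Antitone f) (h0 : ∀ i, n ≤ i → f i = 0)
    (hsum : ∑ i ∈ Finset.range n, f i = n) : ∃ lam : n.Partition, rowLen lam = f := by
  refine ⟨Nat.Partition.ofSums n ((Finset.range n).val.map f) hsum, ?_⟩
  have hcol : ∀ j, colLen (Nat.Partition.ofSums n ((Finset.range n).val.map f) hsum) j =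
      ((Finset.range n).filter fun i => j < f i).card := by
    intro j
    simp only [colLen, Nat.Partition.ofSums, Multiset.filter_filter]
    rw [Multiset.filter_congr (q := fun p => j < p) (by intros; omega), Multiset.filter_map,
      Multiset.card_map]
    rfl
  funext i
  have : ∀ j, j < rowLen (Nat.Partition.ofSums n ((Finset.range n).val.map f) hsum) i ↔
      j < f i := fun j => by
    rw [lt_rowLen_iff, hcol, lt_card_filter_iff hf h0]
  have h1 := this (f i)
  have h2 := this (rowLen (Nat.Partition.ofSums n ((Finset.range n).val.map f) hsum) i)
  omega

lemma mem_cells {n : ℕ} (lam : n.Partition) (s : ℕ × ℕ) :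
    s ∈ cells lam ↔ s.2 < rowLen lam s.1 := by
  simp only [cells, Finset.mem_filter, Finset.mem_product, Finset.mem_range]
  refine ⟨fun h => h.2, fun h => ⟨⟨?_, ?_⟩, h⟩⟩
  · by_contra h1
    rw [rowLen_eq_zero lam (not_lt.1 h1)] at h
    omega
  · by_contra h1
    rw [lt_rowLen_iff, colLen_eq_zero lam (not_lt.1 h1)] at h
    omega

/-- `rho` is obtained from `tau` by adding a box at the end of row `r`. -/
def AddsBox {m : ℕ} (tau : m.Partition) (rho : (m + 1).Partition) (r : ℕ) : Prop :=
  ∀ i, rowLen rho i = rowLen tau i + if i = r then 1 else 0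

namespace AddsBox

variable {m : ℕ} {tau : m.Partition} {rho : (m + 1).Partition} {r : ℕ}

lemma lt (h : AddsBox tau rho r) : r < m + 1 := by
  by_contra hr
  have := h r
  rw [rowLen_eq_zero rho (not_lt.1 hr)] at this
  simp at this

lemma rowLen_self (h : AddsBox tau rho r) : rowLen rho r = rowLen tau r + 1 := by simp [h r]

lemma rowLen_of_ne (h : AddsBox tau rho r) {i : ℕ} (hi : i ≠ r) :
    rowLen rho i = rowLen tau i := by simp [h i, hi]

lemma row_unique (h : AddsBox tau rho r) {r' : ℕ} (h' : AddsBox tau rho r') : r = r' := by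
  by_contra hne
  have h1 := h.rowLen_self
  have h2 := h'.rowLen_of_ne hne
  omega

lemma rho_unique (h : AddsBox tau rho r) {rho' : (m + 1).Partition} (h' : AddsBox tau rho' r) :
    rho = rho' :=
  rowLen_injective (funext fun i => by rw [h i, h' i])

lemma tau_unique (h : AddsBox tau rho r) {tau' : m.Partition} (h' : AddsBox tau' rho r) :
    tau = tau' :=
  rowLen_injective (funext fun i => by have := h i; have := h' i; omega)

lemma cells_eq (h : AddsBox tau rho r) : cells rho = insert (r, rowLen tau r) (cells tau) := by
  ext ⟨i, j⟩
  rw [Finset.mem_insert, mem_cells, mem_cells, h i]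
  by_cases hi : i = r
  · subst hi; simp; omega
  · simp [hi]

lemma notMem (_h : AddsBox tau rho r) : (r, rowLen tau r) ∉ cells tau := by
  rw [mem_cells]; simp

lemma subset (h : AddsBox tau rho r) : cells tau ⊆ cells rho := by
  rw [h.cells_eq]; exact Finset.subset_insert _ _

lemma colLen_corner (h : AddsBox tau rho r) : colLen tau (rowLen tau r) = r := by
  have h1 := lt_rowLen_iff tau r (rowLen tau r)
  rcases Nat.eq_zero_or_pos r with hr | hr
  · omega
  · have h2 := lt_rowLen_iff tau (r - 1) (rowLen tau r)
    have h3 := rowLen_antitone rho (Nat.sub_le r 1)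
    rw [h.rowLen_self, h.rowLen_of_ne (by omega)] at h3
    omega

lemma colLen_eq (h : AddsBox tau rho r) (j : ℕ) :
    colLen rho j = colLen tau j + if j = rowLen tau r then 1 else 0 := by
  have key : ∀ i, i < colLen rho j ↔ i < colLen tau j ∨ (i = r ∧ j = rowLen tau r) := fun i => by
    rw [← lt_rowLen_iff, ← lt_rowLen_iff, h i]
    by_cases hi : i = r
    · subst hi; simp; omega
    · simp [hi]
  have hc := h.colLen_corner
  have h1 := key (colLen rho j)
  have h2 := key (colLen tau j)
  have h3 := key (colLen tau j + 1)
  split_ifs with hj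
  · subst hj; omega
  · omega

lemma nStat_eq (h : AddsBox tau rho r) : nStat rho = nStat tau + r := by
  have : nStat tau = ∑ i ∈ Finset.range (m + 1), i * rowLen tau i := by
    rw [Finset.sum_range_succ, rowLen_eq_zero tau le_rfl]; rfl
  rw [this, nStat]
  simp only [h _, mul_add, Finset.sum_add_distrib]
  simp [h.lt]

lemma rowLen_le (tau : m.Partition) (r : ℕ) : rowLen tau r ≤ m := by
  by_contra hlt
  have := (lt_rowLen_iff tau r m).1 (not_le.1 hlt)
  rw [colLen_eq_zero tau le_rfl] at this
  omega

lemma nStatConj_eq (h : AddsBox tau rho r) :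
    nStatConj rho = nStatConj tau + rowLen tau r := by
  have : nStatConj tau = ∑ j ∈ Finset.range (m + 1), j * colLen tau j := by
    rw [Finset.sum_range_succ, colLen_eq_zero tau le_rfl]; rfl
  rw [this, nStatConj]
  have := rowLen_le tau r
  simp only [h.colLen_eq _, mul_add, Finset.sum_add_distrib]
  simp; omega

end AddsBox

lemma exists_addsBox_of_subset {m : ℕ} {tau : m.Partition} {rho : (m + 1).Partition}
    (h : cells tau ⊆ cells rho) : ∃ r, AddsBox tau rho r := by
  have hle : ∀ i, rowLen tau i ≤ rowLen rho i := fun i => by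
    by_contra hlt
    have := h ((mem_cells tau (i, rowLen rho i)).2 (not_le.1 hlt))
    rw [mem_cells] at this
    exact lt_irrefl _ this
  have hsum : ∑ i ∈ Finset.range (m + 1), (rowLen rho i - rowLen tau i) = 1 := by
    have h1 : ∑ i ∈ Finset.range (m + 1), (rowLen rho i - rowLen tau i) +
        ∑ i ∈ Finset.range (m + 1), rowLen tau i = m + 1 := by
      rw [← Finset.sum_add_distrib]
      refine Eq.trans (Finset.sum_congr rfl fun i _ => ?_) (sum_rowLen rho)
      exact Nat.sub_add_cancel (hle i)
    rw [Finset.sum_range_succ (fun i => rowLen tau i), sum_rowLen,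
      rowLen_eq_zero tau le_rfl] at h1
    omega
  obtain ⟨r, hr, hr0⟩ := Finset.exists_ne_zero_of_sum_ne_zero (by rw [hsum]; exact one_ne_zero)
  refine ⟨r, fun i => ?_⟩
  rw [← Finset.add_sum_erase _ _ hr] at hsum
  split_ifs with hi
  · subst hi
    have := hle i
    omega
  · by_cases him : i < m + 1
    · have h2 : ∑ i ∈ (Finset.range (m + 1)).erase r, (rowLen rho i - rowLen tau i) = 0 := by
        omega
      have := Finset.sum_eq_zero_iff.1 h2 i (by simp [hi, him])
      have := hle i
      omega
    · rw [rowLen_eq_zero rho (by omega), rowLen_eq_zero tau (by omega)]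

lemma exists_addsBox_above {m r : ℕ} (tau : m.Partition) (hr : r < m + 1)
    (h : r = 0 ∨ rowLen tau r ≠ rowLen tau (r - 1)) : ∃ rho, AddsBox tau rho r := by
  have hanti : Antitone fun i => rowLen tau i + if i = r then 1 else 0 := by
    refine antitone_nat_of_succ_le fun i => ?_
    have h1 := rowLen_antitone tau (Nat.le_succ i)
    by_cases hi : i + 1 = r
    · subst hi
      simp at h
      simp
      simp at h1
      omega
    · simp only [hi, if_false]
      simp at h1
      omega
  obtain ⟨rho, hrho⟩ := exists_rowLen_eq (n := m + 1) hanti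
    (fun i hi => by simp [rowLen_eq_zero tau (show m ≤ i by omega)]; omega)
    (by
      rw [Finset.sum_add_distrib, Finset.sum_range_succ, sum_rowLen, rowLen_eq_zero tau le_rfl]
      simp; omega)
  exact ⟨rho, fun i => congrFun hrho i⟩

lemma exists_addsBox_below {m r : ℕ} (rho : (m + 1).Partition)
    (h : rowLen rho (r + 1) ≠ rowLen rho r) : ∃ tau, AddsBox tau rho r := by
  have hlt : rowLen rho (r + 1) < rowLen rho r :=
    lt_of_le_of_ne (rowLen_antitone rho (Nat.le_succ r)) h
  have hadd : ∀ i, (rowLen rho i - if i = r then 1 else 0) + (if i = r then 1 else 0) =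
      rowLen rho i := fun i => by
    split_ifs with hi
    · subst hi; omega
    · rfl
  have hr : r < m + 1 := by
    by_contra hr
    rw [rowLen_eq_zero rho (not_lt.1 hr)] at hlt
    omega
  have hanti : Antitone fun i => rowLen rho i - if i = r then 1 else 0 := by
    refine antitone_nat_of_succ_le fun i => ?_
    have h1 := rowLen_antitone rho (Nat.le_succ i)
    by_cases hi : i = r
    · subst hi
      simp
      omega
    · simp only [hi, if_false]
      simp at h1
      omega
  have hsum : ∑ i ∈ Finset.range (m + 1), (rowLen rho i - if i = r then 1 else 0) = m := by
    have h1 : ∑ i ∈ Finset.range (m + 1), (rowLen rho i - if i = r then 1 else 0) +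
        ∑ i ∈ Finset.range (m + 1), (if i = r then 1 else 0) = m + 1 := by
      rw [← Finset.sum_add_distrib]
      exact Eq.trans (Finset.sum_congr rfl fun i _ => hadd i) (sum_rowLen rho)
    rw [Finset.sum_ite_eq' (Finset.range (m + 1)) r] at h1
    simp only [Finset.mem_range, hr, if_true] at h1
    omega
  have h0 : rowLen rho m - (if m = r then 1 else 0) = 0 := by
    by_contra h0
    have h1 : ∀ i ∈ Finset.range (m + 1), 1 ≤ rowLen rho i - if i = r then 1 else 0 :=
      fun i hi => by
        have := hanti (Nat.lt_succ_iff.1 (Finset.mem_range.1 hi))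
        simp only at this
        omega
    have h2 := Finset.card_nsmul_le_sum _ _ _ h1
    rw [hsum] at h2
    simp at h2
  obtain ⟨tau, htau⟩ := exists_rowLen_eq (n := m) hanti
    (fun i hi => by
      have := hanti hi
      simp only at this
      omega)
    (by rw [Finset.sum_range_succ, h0] at hsum; exact hsum)
  exact ⟨tau, fun i => by rw [htau]; exact (hadd i).symm⟩

lemma sum_eq_sum_range_of_rel {A : Type*} [Fintype A] {N : ℕ} (Rel : A → ℕ → Prop)
    (hlt : ∀ a r, Rel a r → r < N) (hr : ∀ a r r', Rel a r → Rel a r' → r = r')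
    (ha : ∀ a a' r, Rel a r → Rel a' r → a = a') (G : A → ℝ) (g : ℕ → ℝ)
    (hG : ∀ a r, Rel a r → G a = g r) (hG0 : ∀ a, (¬∃ r, Rel a r) → G a = 0)
    (hg0 : ∀ r < N, (¬∃ a, Rel a r) → g r = 0) :
    ∑ a, G a = ∑ r ∈ Finset.range N, g r := by
  classical
  have h1 : ∀ a, G a = ∑ r ∈ Finset.range N, if Rel a r then g r else 0 := fun a => by
    by_cases h : ∃ r, Rel a r
    · obtain ⟨r, h⟩ := h
      rw [Finset.sum_eq_single r, if_pos h, hG a r h]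
      · intro r' _ hne
        rw [if_neg fun h' => hne (hr a _ _ h' h)]
      · intro hn
        exact absurd (Finset.mem_range.2 (hlt a r h)) hn
    · rw [hG0 a h, Finset.sum_eq_zero fun r _ => if_neg fun h' => h ⟨r, h'⟩]
  simp only [h1]
  rw [Finset.sum_comm]
  refine Finset.sum_congr rfl fun r hrN => ?_
  by_cases h : ∃ a, Rel a r
  · obtain ⟨a, h⟩ := h
    rw [Finset.sum_eq_single a, if_pos h]
    · intro a' _ hne
      rw [if_neg fun h' => hne (ha _ _ r h' h)]
    · simp
  · rw [hg0 r (Finset.mem_range.1 hrN) h, Finset.sum_eq_zero fun a _ => if_neg fun h' => h ⟨a, h'⟩]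

namespace AddsBox

variable {m : ℕ} {tau : m.Partition} {rho : (m + 1).Partition} {r : ℕ}

lemma prod_cells (h : AddsBox tau rho r) (F : ℕ × ℕ → ℝ)
    (hF : ∀ i j, i ≠ r → j ≠ rowLen tau r → F (i, j) = 1) :
    ∏ s ∈ cells tau, F s =
      (∏ j ∈ Finset.range (rowLen tau r), F (r, j)) *
        ∏ i ∈ Finset.range r, F (i, rowLen tau r) := by
  have hcol : ∀ i, rowLen tau r < rowLen tau i ↔ i < r := fun i => by
    rw [lt_rowLen_iff, h.colLen_corner]
  rw [← Finset.prod_image (s := Finset.range (rowLen tau r)) (g := fun j => (r, j))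
      (fun _ _ _ _ h => (Prod.ext_iff.1 h).2),
    ← Finset.prod_image (s := Finset.range r) (g := fun i => (i, rowLen tau r))
      (fun _ _ _ _ h => (Prod.ext_iff.1 h).1), ← Finset.prod_union]
  · symm
    apply Finset.prod_subset
    · rintro ⟨i, j⟩ hs
      rw [mem_cells]
      simp only [Finset.mem_union, Finset.mem_image, Finset.mem_range, Prod.mk.injEq] at hs
      rcases hs with ⟨j', h1, rfl, rfl⟩ | ⟨i', h1, rfl, rfl⟩
      · exact h1
      · exact (hcol i').2 h1
    · rintro ⟨i, j⟩ hs hn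
      simp only [Finset.mem_union, Finset.mem_image, Finset.mem_range, Prod.mk.injEq,
        not_or, not_exists, not_and] at hn
      rw [mem_cells] at hs
      refine hF i j (fun hi => ?_) (fun hj => ?_)
      · subst hi
        exact hn.1 j hs rfl rfl
      · subst hj
        exact hn.2 i ((hcol i).1 hs) rfl rfl
  · rw [Finset.disjoint_left]
    rintro ⟨i, j⟩ h1 h2
    simp only [Finset.mem_image, Finset.mem_range, Prod.mk.injEq] at h1 h2
    omega

lemma psi'_eq (h : AddsBox tau rho r) (α : ℝ) :
    psi' α rho tau = ∏ i ∈ Finset.range r,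
      (α * arm rho (i, rowLen tau r) + leg rho (i, rowLen tau r) + 1) /
        (α * arm rho (i, rowLen tau r) + leg rho (i, rowLen tau r) + α) *
      ((α * arm tau (i, rowLen tau r) + leg tau (i, rowLen tau r) + α) /
        (α * arm tau (i, rowLen tau r) + leg tau (i, rowLen tau r) + 1)) := by
  unfold psi'
  rw [if_pos h.subset]
  have hcol : ∀ i, rowLen tau r < rowLen tau i ↔ i < r := fun i => by
    rw [lt_rowLen_iff, h.colLen_corner]
  have hdiff : ∀ t, t ∈ cells rho \ cells tau ↔ t = (r, rowLen tau r) := fun t => by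
    rw [h.cells_eq, Finset.mem_sdiff, Finset.mem_insert]
    have := h.notMem
    constructor
    · rintro ⟨h1 | h1, h2⟩
      · exact h1
      · exact absurd h1 h2
    · rintro rfl
      exact ⟨Or.inl rfl, this⟩
  rw [← Finset.prod_image (s := Finset.range r) (g := fun i => (i, rowLen tau r))
      (f := fun s => (α * arm rho s + leg rho s + 1) / (α * arm rho s + leg rho s + α) *
        ((α * arm tau s + leg tau s + α) / (α * arm tau s + leg tau s + 1)))
      (fun _ _ _ _ h => (Prod.ext_iff.1 h).1)]
  refine Finset.prod_congr ?_ fun _ _ => rfl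
  ext ⟨i, j⟩
  simp only [hdiff, exists_eq_left]
  simp only [Finset.mem_sdiff, Finset.mem_filter, Finset.mem_image, Finset.mem_range,
    Prod.mk.injEq, h.cells_eq, Finset.mem_insert, mem_cells]
  constructor
  · rintro ⟨⟨h1, rfl⟩, h2⟩
    refine ⟨i, (hcol i).1 ?_, rfl, rfl⟩
    rcases h1 with ⟨rfl, -⟩ | h1
    · exact absurd ⟨Or.inl ⟨rfl, rfl⟩, rfl⟩ h2
    · exact h1
  · rintro ⟨i', h1, rfl, rfl⟩
    exact ⟨⟨Or.inr ((hcol i').2 h1), rfl⟩, fun h2 => by omega⟩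

lemma arm_of_ne (h : AddsBox tau rho r) {i : ℕ} (hi : i ≠ r) (j : ℕ) :
    arm rho (i, j) = arm tau (i, j) := by
  simp [arm, h.rowLen_of_ne hi]

lemma leg_of_ne (h : AddsBox tau rho r) (i : ℕ) {j : ℕ} (hj : j ≠ rowLen tau r) :
    leg rho (i, j) = leg tau (i, j) := by
  simp [leg, h.colLen_eq, hj]

lemma arm_row (h : AddsBox tau rho r) {j : ℕ} (hj : j < rowLen tau r) :
    (arm tau (r, j) : ℝ) = rowLen tau r - j - 1 ∧ (arm rho (r, j) : ℝ) = rowLen tau r - j := by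
  constructor
  · rw [arm, Nat.cast_sub (by simpa using hj)]; push_cast; ring
  · rw [arm, h.rowLen_self, Nat.cast_sub (by simp; omega)]; push_cast; ring

lemma leg_col (h : AddsBox tau rho r) {i : ℕ} (hi : i < r) :
    (leg tau (i, rowLen tau r) : ℝ) = r - i - 1 ∧ (leg rho (i, rowLen tau r) : ℝ) = r - i := by
  constructor
  · rw [leg, h.colLen_corner, Nat.cast_sub (by simpa using hi)]; push_cast; ring
  · rw [leg, h.colLen_eq, h.colLen_corner, Nat.cast_sub (by simp; omega)]; simp

lemma arm_col (h : AddsBox tau rho r) {i : ℕ} (hi : i < r) :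
    (arm tau (i, rowLen tau r) : ℝ) = rowLen tau i - rowLen tau r - 1 := by
  have : rowLen tau r < rowLen tau i := by rwa [lt_rowLen_iff, h.colLen_corner]
  rw [arm, Nat.cast_sub (by simpa using this)]; push_cast; ring

lemma leg_row (_h : AddsBox tau rho r) {j : ℕ} (hj : j < rowLen tau r) :
    (leg tau (r, j) : ℝ) = colLen tau j - r - 1 := by
  have := (lt_rowLen_iff tau r j).1 hj
  rw [leg, Nat.cast_sub (by simpa using this)]; push_cast; ring

end AddsBox

lemma cLow_pos {α : ℝ} (hα : 0 < α) {n : ℕ} (lam : n.Partition) : 0 < cLow α lam :=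
  Finset.prod_pos fun _ _ => by positivity

lemma cUp_pos {α : ℝ} (hα : 0 < α) {n : ℕ} (lam : n.Partition) : 0 < cUp α lam :=
  Finset.prod_pos fun _ _ => by positivity

lemma psi'_nonneg {α : ℝ} (hα : 0 < α) {n : ℕ} (lam : n.Partition) (tau : (n - 1).Partition) :
    0 ≤ psi' α lam tau := by
  unfold psi'
  split_ifs
  · exact Finset.prod_nonneg fun _ _ => by positivity
  · exact le_rfl

/-- The probability of growing `tau` to `rho` in the Jack growth process. -/
noncomputable def upProb (α : ℝ) {m : ℕ} (tau : m.Partition) (rho : (m + 1).Partition) : ℝ :=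
  cLow α tau * psi' α rho tau / cLow α rho

/-- The probability of shrinking `rho` to `tau`. -/
noncomputable def downProb (α : ℝ) {m : ℕ} (tau : m.Partition) (rho : (m + 1).Partition) : ℝ :=
  cUp α rho * psi' α rho tau / (α * (m + 1) * cUp α tau)

/-- The `α`-content of the corner at the end of row `i`. -/
noncomputable def rowEnd (α : ℝ) {m : ℕ} (tau : m.Partition) (i : ℕ) : ℝ :=
  α * rowLen tau i - i

lemma prod_Ico_div_telescope {g : ℕ → ℝ} {a b : ℕ} (hab : a ≤ b)
    (hg : ∀ j, a ≤ j → j ≤ b → g j ≠ 0) :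
    ∏ j ∈ Finset.Ico a b, g (j + 1) / g j = g b / g a := by
  induction b, hab using Nat.le_induction with
  | base => simp [hg a le_rfl le_rfl]
  | succ b hab ih =>
    rw [Finset.prod_Ico_succ_top hab, ih fun j h1 h2 => hg j h1 (by omega)]
    have := hg b hab (by omega)
    have := hg a le_rfl (by omega)
    field_simp

/-- Regroup a product over the columns of row `k` by the rows where these columns end. -/
lemma prod_columns_eq_prod_rows {m : ℕ} (tau : m.Partition) (h : ℕ → ℕ → ℝ) {k : ℕ} (K : ℕ)
    (hkK : k ≤ K) (hK : m ≤ K)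
    (hne : ∀ i j, k ≤ i → j ≤ rowLen tau i → h (i + 1) j ≠ 0) :
    ∏ j ∈ Finset.range (rowLen tau k), h (colLen tau j) (j + 1) / h (colLen tau j) j =
      ∏ i ∈ Finset.Ico k K, h (i + 1) (rowLen tau i) / h (i + 1) (rowLen tau (i + 1)) := by
  obtain ⟨d, rfl⟩ := Nat.exists_eq_add_of_le hkK
  clear hkK
  induction d generalizing k with
  | zero =>
    rw [rowLen_eq_zero tau (by omega)]
    simp
  | succ d ih =>
    have hle := rowLen_antitone tau (Nat.le_succ k)
    rw [← Finset.prod_range_mul_prod_Ico _ hle, show k + (d + 1) = k + 1 + d by ring,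
      ih (k := k + 1) (fun i j hi => hne i j (by omega)) (by omega),
      Finset.prod_eq_prod_Ico_succ_bot (show k < k + 1 + d by omega), mul_comm]
    congr 1
    rw [← prod_Ico_div_telescope (g := fun j => h (k + 1) j) hle
      fun j _ h2 => hne k j le_rfl h2]
    refine Finset.prod_congr rfl fun j hj => ?_
    rw [Finset.mem_Ico] at hj
    have : colLen tau j = k + 1 := by
      have h1 := lt_rowLen_iff tau k j
      have h2 := lt_rowLen_iff tau (k + 1) j
      simp only [Nat.succ_eq_add_one] at hj
      omega
    rw [this]

lemma rowEnd_strictAnti {α : ℝ} (hα : 0 < α) {m : ℕ} (tau : m.Partition) :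
    StrictAnti (rowEnd α tau) := by
  intro i k hik
  unfold rowEnd
  have h1 : (rowLen tau k : ℝ) ≤ rowLen tau i := by exact_mod_cast rowLen_antitone tau hik.le
  have h2 : (i : ℝ) < k := by exact_mod_cast hik
  have := mul_le_mul_of_nonneg_left h1 hα.le
  linarith

lemma rowEnd_of_le (α : ℝ) {m : ℕ} (tau : m.Partition) {i : ℕ} (h : m ≤ i) :
    rowEnd α tau i = -i := by
  simp [rowEnd, rowLen_eq_zero tau h]

lemma prod_range_erase {N r : ℕ} (hr : r < N) (g : ℕ → ℝ) :
    ∏ i ∈ (Finset.range N).erase r, g i =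
      (∏ i ∈ Finset.range r, g i) * ∏ i ∈ Finset.Ico (r + 1) N, g i := by
  rw [← Finset.prod_union]
  · refine Finset.prod_congr ?_ fun _ _ => rfl
    ext i
    simp only [Finset.mem_erase, Finset.mem_range, Finset.mem_union, Finset.mem_Ico]
    omega
  · rw [Finset.disjoint_left]
    intro i
    simp only [Finset.mem_range, Finset.mem_Ico]
    omega

namespace AddsBox

variable {m : ℕ} {tau : m.Partition} {rho : (m + 1).Partition} {r : ℕ} {α : ℝ}

lemma upProb_eq (h : AddsBox tau rho r) (hα : 0 < α) :
    upProb α tau rho = (∏ i ∈ Finset.range m, (rowEnd α tau r - (rowEnd α tau i - 1))) /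
      ∏ i ∈ (Finset.range (m + 1)).erase r, (rowEnd α tau r - rowEnd α tau i) := by
  have hlow : cLow α rho = ∏ s ∈ cells tau, (α * arm rho s + leg rho s + 1) := by
    rw [cLow, h.cells_eq, Finset.prod_insert h.notMem]
    simp [arm, leg, h.rowLen_self, h.colLen_eq, h.colLen_corner]
  have hrow : ∏ j ∈ Finset.range (rowLen tau r),
      (α * arm tau (r, j) + leg tau (r, j) + 1) / (α * arm rho (r, j) + leg rho (r, j) + 1) =
      (∏ i ∈ Finset.Ico r m, (rowEnd α tau r - (rowEnd α tau i - 1))) /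
        ∏ i ∈ Finset.Ico (r + 1) (m + 1), (rowEnd α tau r - rowEnd α tau i) := by
    have key := prod_columns_eq_prod_rows tau
      (fun i j => α * ((rowLen tau r : ℝ) - j) + i - r) (k := r) m
      (Nat.lt_succ_iff.1 h.lt) le_rfl (by
        intro i j hi hj
        have h1 : (r : ℝ) ≤ i := by exact_mod_cast hi
        have h2 : (j : ℝ) ≤ rowLen tau r := by exact_mod_cast hj.trans (rowLen_antitone tau hi)
        have := mul_nonneg hα.le (sub_nonneg.2 h2)
        push_cast
        linarith)
    rw [← Finset.prod_Ico_add' _ r m 1, ← Finset.prod_div_distrib]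
    refine Eq.trans (Finset.prod_congr rfl fun j hj => ?_)
      (key.trans (Finset.prod_congr rfl fun i _ => ?_))
    · rw [Finset.mem_range] at hj
      rw [h.leg_of_ne r hj.ne, (h.arm_row hj).1, (h.arm_row hj).2, h.leg_row hj]
      push_cast
      congr 1 <;> ring
    · simp only [rowEnd]
      push_cast
      congr 1 <;> ring
  have hcol : (∏ i ∈ Finset.range r,
      (α * arm tau (i, rowLen tau r) + leg tau (i, rowLen tau r) + 1) /
        (α * arm rho (i, rowLen tau r) + leg rho (i, rowLen tau r) + 1)) * psi' α rho tau =
      (∏ i ∈ Finset.range r, (rowEnd α tau r - (rowEnd α tau i - 1))) /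
        ∏ i ∈ Finset.range r, (rowEnd α tau r - rowEnd α tau i) := by
    rw [h.psi'_eq, ← Finset.prod_mul_distrib, ← Finset.prod_div_distrib]
    refine Finset.prod_congr rfl fun i hi => ?_
    rw [Finset.mem_range] at hi
    have e1 : (α * arm tau (i, rowLen tau r) + leg tau (i, rowLen tau r) + α) =
        -(rowEnd α tau r - (rowEnd α tau i - 1)) := by
      rw [h.arm_col hi, (h.leg_col hi).1, rowEnd, rowEnd]; ring
    have e2 : (α * arm rho (i, rowLen tau r) + leg rho (i, rowLen tau r) + α) =
        -(rowEnd α tau r - rowEnd α tau i) := by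
      rw [h.arm_of_ne hi.ne, h.arm_col hi, (h.leg_col hi).2, rowEnd, rowEnd]; ring
    rw [e1, e2]
    have p1 : (α * arm tau (i, rowLen tau r) + leg tau (i, rowLen tau r) + 1 : ℝ) ≠ 0 := by
      positivity
    have p2 : (α * arm rho (i, rowLen tau r) + leg rho (i, rowLen tau r) + 1 : ℝ) ≠ 0 := by
      positivity
    have p3 : rowEnd α tau r - rowEnd α tau i ≠ 0 :=
      (sub_neg.2 (rowEnd_strictAnti hα tau hi)).ne
    field_simp
  have hcell := h.prod_cells
    (fun s => (α * arm tau s + leg tau s + 1) / (α * arm rho s + leg rho s + 1)) (by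
      intro i j hi hj
      have : (α * arm tau (i, j) + leg tau (i, j) + 1 : ℝ) ≠ 0 := by positivity
      simp only [h.arm_of_ne hi, h.leg_of_ne i hj, div_self this])
  have hup : upProb α tau rho =
      (∏ s ∈ cells tau,
        (α * arm tau s + leg tau s + 1) / (α * arm rho s + leg rho s + 1)) * psi' α rho tau := by
    rw [upProb, hlow, cLow, Finset.prod_div_distrib]; ring
  rw [hup, hcell, mul_assoc, hcol, hrow, prod_range_erase h.lt,
    ← Finset.prod_range_mul_prod_Ico _ (Nat.lt_succ_iff.1 h.lt)]
  rw [div_mul_div_comm, mul_comm, mul_comm (∏ i ∈ Finset.range r, (rowEnd α tau r - rowEnd α tau i))]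

lemma downProb_eq (h : AddsBox tau rho r) (hα : 0 < α) :
    downProb α tau rho = -1 / (α * (m + 1)) *
      ((∏ i ∈ Finset.range (m + 2), ((rowEnd α rho r - 1) - rowEnd α rho i)) /
      ∏ i ∈ (Finset.range (m + 1)).erase r, ((rowEnd α rho r - 1) - (rowEnd α rho i - 1))) := by
  have hup : cUp α rho = α * ∏ s ∈ cells tau, (α * arm rho s + leg rho s + α) := by
    rw [cUp, h.cells_eq, Finset.prod_insert h.notMem]
    simp [arm, leg, h.rowLen_self, h.colLen_eq, h.colLen_corner]
  have hrow : α * ∏ j ∈ Finset.range (rowLen tau r),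
      (α * arm rho (r, j) + leg rho (r, j) + α) / (α * arm tau (r, j) + leg tau (r, j) + α) =
      (∏ i ∈ Finset.Ico (r + 1) (m + 2), ((rowEnd α rho r - 1) - rowEnd α rho i)) /
        ∏ i ∈ Finset.Ico (r + 1) (m + 1), ((rowEnd α rho r - 1) - (rowEnd α rho i - 1)) := by
    have key := prod_columns_eq_prod_rows tau
      (fun i j => α * ((rowLen tau r : ℝ) + 1 - j) + i - (r + 1)) (k := r) (m + 1)
      h.lt.le (Nat.le_succ m) (by
        intro i j hi hj
        have h1 : (r : ℝ) ≤ i := by exact_mod_cast hi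
        have h2 : (j : ℝ) ≤ rowLen tau r := by exact_mod_cast hj.trans (rowLen_antitone tau hi)
        have := mul_nonneg hα.le (sub_nonneg.2 h2)
        push_cast
        nlinarith)
    have hinv : ∏ j ∈ Finset.range (rowLen tau r),
        (α * arm rho (r, j) + leg rho (r, j) + α) / (α * arm tau (r, j) + leg tau (r, j) + α) =
        (∏ j ∈ Finset.range (rowLen tau r),
          (α * ((rowLen tau r : ℝ) + 1 - ((j + 1 : ℕ) : ℝ)) + colLen tau j - (r + 1)) /
            (α * ((rowLen tau r : ℝ) + 1 - j) + colLen tau j - (r + 1)))⁻¹ := by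
      rw [← Finset.prod_inv_distrib]
      refine Finset.prod_congr rfl fun j hj => ?_
      rw [Finset.mem_range] at hj
      rw [h.leg_of_ne r hj.ne, (h.arm_row hj).1, (h.arm_row hj).2, h.leg_row hj, inv_div]
      push_cast
      congr 1 <;> ring
    rw [hinv, key, Finset.prod_div_distrib, inv_div, Finset.prod_eq_prod_Ico_succ_bot h.lt
      (fun i => α * ((rowLen tau r : ℝ) + 1 - rowLen tau i) + ((i + 1 : ℕ) : ℝ) - (r + 1)),
      ← Finset.prod_Ico_add' _ r (m + 1) 1]
    have e1 : α * ((rowLen tau r : ℝ) + 1 - rowLen tau r) + ((r + 1 : ℕ) : ℝ) - (r + 1) = α := by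
      push_cast; ring
    rw [e1, ← mul_div_assoc, mul_div_mul_left _ _ hα.ne']
    congr 1
    · refine Finset.prod_congr rfl fun i hi => ?_
      rw [Finset.mem_Ico] at hi
      rw [rowEnd, rowEnd, h.rowLen_self, h.rowLen_of_ne (by omega)]
      push_cast; ring
    · refine Finset.prod_congr rfl fun i hi => ?_
      rw [Finset.mem_Ico] at hi
      rw [rowEnd, rowEnd, h.rowLen_self, h.rowLen_of_ne (by omega)]
      push_cast; ring
  have hcol : (∏ i ∈ Finset.range r,
      (α * arm rho (i, rowLen tau r) + leg rho (i, rowLen tau r) + α) /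
        (α * arm tau (i, rowLen tau r) + leg tau (i, rowLen tau r) + α)) * psi' α rho tau =
      (∏ i ∈ Finset.range r, ((rowEnd α rho r - 1) - rowEnd α rho i)) /
        ∏ i ∈ Finset.range r, ((rowEnd α rho r - 1) - (rowEnd α rho i - 1)) := by
    rw [h.psi'_eq, ← Finset.prod_mul_distrib, ← Finset.prod_div_distrib]
    refine Finset.prod_congr rfl fun i hi => ?_
    rw [Finset.mem_range] at hi
    have e1 : (α * arm rho (i, rowLen tau r) + leg rho (i, rowLen tau r) + 1) =
        -((rowEnd α rho r - 1) - rowEnd α rho i) := by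
      rw [h.arm_of_ne hi.ne, h.arm_col hi, (h.leg_col hi).2, rowEnd, rowEnd, h.rowLen_self,
        h.rowLen_of_ne hi.ne]
      push_cast; ring
    have e2 : (α * arm tau (i, rowLen tau r) + leg tau (i, rowLen tau r) + 1) =
        -((rowEnd α rho r - 1) - (rowEnd α rho i - 1)) := by
      rw [h.arm_col hi, (h.leg_col hi).1, rowEnd, rowEnd, h.rowLen_self,
        h.rowLen_of_ne hi.ne]
      push_cast; ring
    rw [e1, e2]
    have p1 : (α * arm tau (i, rowLen tau r) + leg tau (i, rowLen tau r) + α : ℝ) ≠ 0 := by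
      positivity
    have p2 : (α * arm rho (i, rowLen tau r) + leg rho (i, rowLen tau r) + α : ℝ) ≠ 0 := by
      positivity
    have p3 : (rowEnd α rho r - 1) - (rowEnd α rho i - 1) ≠ 0 := by
      have := rowEnd_strictAnti hα rho hi
      linarith
    field_simp
  have hcell := h.prod_cells
    (fun s => (α * arm rho s + leg rho s + α) / (α * arm tau s + leg tau s + α)) (by
      intro i j hi hj
      have : (α * arm tau (i, j) + leg tau (i, j) + α : ℝ) ≠ 0 := by positivity
      simp only [h.arm_of_ne hi, h.leg_of_ne i hj, div_self this])
  have hdown : downProb α tau rho = 1 / (α * (m + 1)) *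
      (α * (∏ s ∈ cells tau,
        (α * arm rho s + leg rho s + α) / (α * arm tau s + leg tau s + α)) * psi' α rho tau) := by
    rw [downProb, hup, cUp, Finset.prod_div_distrib]
    have := (cUp_pos hα tau).ne'
    rw [cUp] at this
    field_simp
  have assoc : ∀ a b c d : ℝ, a * (b * c) * d = a * b * (c * d) := fun _ _ _ _ => by ring
  rw [hdown, hcell, assoc, hcol, hrow, prod_range_erase h.lt,
    ← Finset.mul_prod_erase _ _ (Finset.mem_range.2 (Nat.lt_succ_of_lt h.lt)),
    prod_range_erase (Nat.lt_succ_of_lt h.lt)]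
  rw [div_mul_div_comm, mul_comm (∏ i ∈ Finset.range r, ((rowEnd α rho r - 1) - (rowEnd α rho i - 1)))]
  ring

end AddsBox

lemma upProb_nonneg {α : ℝ} (hα : 0 < α) {m : ℕ} (tau : m.Partition) (rho : (m + 1).Partition) :
    0 ≤ upProb α tau rho :=
  div_nonneg (mul_nonneg (cLow_pos hα tau).le (psi'_nonneg hα rho tau)) (cLow_pos hα rho).le

lemma psi'_eq_zero {m : ℕ} {tau : m.Partition} {rho : (m + 1).Partition}
    (h : ¬∃ r, AddsBox tau rho r) (α : ℝ) : psi' α rho tau = 0 :=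
  if_neg fun hs => h (exists_addsBox_of_subset hs)

/-- The `α`-content of the box added when passing from `tau` to `rho`. -/
noncomputable def content (α : ℝ) {m : ℕ} (tau : m.Partition) (rho : (m + 1).Partition) : ℝ :=
  (α * nStatConj rho - nStat rho) - (α * nStatConj tau - nStat tau)

lemma AddsBox.content_eq {m : ℕ} {tau : m.Partition} {rho : (m + 1).Partition} {r : ℕ}
    (h : AddsBox tau rho r) (α : ℝ) : content α tau rho = rowEnd α tau r := by
  rw [content, h.nStatConj_eq, h.nStat_eq, rowEnd]
  push_cast
  ring

lemma sum_upProb_mul_content {α : ℝ} (hα : 0 < α) {m : ℕ} (tau : m.Partition) (f : ℝ → ℝ) :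
    ∑ rho, upProb α tau rho * f (content α tau rho) =
      dividedDiff (Finset.range (m + 1)) (rowEnd α tau)
        (fun z => f z * ∏ i ∈ Finset.range m, (z - (rowEnd α tau i - 1))) := by
  refine sum_eq_sum_range_of_rel (fun rho r => AddsBox tau rho r) (fun _ _ h => h.lt)
    (fun _ _ _ h h' => h.row_unique h') (fun _ _ _ h h' => h.rho_unique h') _ _ ?_ ?_ ?_
  · intro rho r h
    rw [h.upProb_eq hα, h.content_eq]
    ring
  · intro rho h
    simp [upProb, psi'_eq_zero h]
  · intro r hr h
    have hcorner : ¬(r = 0 ∨ rowLen tau r ≠ rowLen tau (r - 1)) := fun hc =>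
      h (exists_addsBox_above tau hr hc)
    push Not at hcorner
    have h1 : 1 ≤ r := Nat.one_le_iff_ne_zero.2 hcorner.1
    beta_reduce
    rw [Finset.prod_eq_zero (i := r - 1) (Finset.mem_range.2 (by omega)), mul_zero, zero_div]
    rw [rowEnd, rowEnd, hcorner.2, Nat.cast_sub h1]
    push_cast
    ring

/-- The power sums of the interlacing coordinates of `tau`. -/
noncomputable def rowPowerSum (α : ℝ) {m : ℕ} (tau : m.Partition) (k : ℕ) : ℝ :=
  rowEnd α tau m ^ k + ∑ i ∈ Finset.range m, (rowEnd α tau i ^ k - (rowEnd α tau i - 1) ^ k)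

lemma sum_range_cast (m : ℕ) : ∑ i ∈ Finset.range m, (i : ℝ) = m * (m - 1) / 2 := by
  induction m with
  | zero => simp
  | succ m ih => rw [Finset.sum_range_succ, ih]; push_cast; ring

lemma sum_rowEnd (α : ℝ) {m : ℕ} (tau : m.Partition) :
    ∑ i ∈ Finset.range m, rowEnd α tau i = α * m - m * (m - 1) / 2 := by
  have h : ∑ i ∈ Finset.range m, (rowLen tau i : ℝ) = m := by exact_mod_cast sum_rowLen tau
  simp only [rowEnd, Finset.sum_sub_distrib, ← Finset.mul_sum, h, sum_range_cast]

lemma rowPowerSum_one (α : ℝ) {m : ℕ} (tau : m.Partition) : rowPowerSum α tau 1 = 0 := by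
  simp [rowPowerSum, rowEnd_of_le α tau le_rfl]

lemma rowPowerSum_two (α : ℝ) {m : ℕ} (tau : m.Partition) :
    rowPowerSum α tau 2 = 2 * α * m := by
  have h : ∀ i, rowEnd α tau i ^ 2 - (rowEnd α tau i - 1) ^ 2 = 2 * rowEnd α tau i - 1 :=
    fun i => by ring
  simp only [rowPowerSum, rowEnd_of_le α tau le_rfl, h, Finset.sum_sub_distrib, ← Finset.mul_sum,
    sum_rowEnd]
  simp
  ring

lemma AddsBox.rowPowerSum_eq {m : ℕ} {tau : m.Partition} {rho : (m + 1).Partition} {r : ℕ}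
    (h : AddsBox tau rho r) (α : ℝ) (k : ℕ) :
    rowPowerSum α rho k = rowPowerSum α tau k +
      (((rowEnd α tau r + α) ^ k - (rowEnd α tau r + α - 1) ^ k) -
        (rowEnd α tau r ^ k - (rowEnd α tau r - 1) ^ k)) := by
  have hr : r ∈ Finset.range (m + 1) := Finset.mem_range.2 h.lt
  have hself : rowEnd α rho r = rowEnd α tau r + α := by
    rw [rowEnd, rowEnd, h.rowLen_self]; push_cast; ring
  have hpad : rowPowerSum α tau k = rowEnd α rho (m + 1) ^ k +
      ∑ i ∈ Finset.range (m + 1), (rowEnd α tau i ^ k - (rowEnd α tau i - 1) ^ k) := by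
    rw [rowPowerSum, Finset.sum_range_succ, rowEnd_of_le α tau le_rfl, rowEnd_of_le α rho le_rfl]
    push_cast
    ring
  rw [hpad, rowPowerSum, ← Finset.add_sum_erase _ _ hr, ← Finset.add_sum_erase _ _ hr, hself,
    Finset.sum_congr rfl fun i hi => by
      rw [rowEnd, h.rowLen_of_ne (Finset.ne_of_mem_erase hi), ← rowEnd]]
  ring

lemma upProb_moments {α : ℝ} (hα : 0 < α) {m : ℕ} (tau : m.Partition) :
    ∑ rho, upProb α tau rho = 1 ∧
    ∑ rho, upProb α tau rho * content α tau rho = 0 ∧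
    ∑ rho, upProb α tau rho * content α tau rho ^ 2 = α * m ∧
    ∑ rho, upProb α tau rho * content α tau rho ^ 4 =
      α ^ 2 * m ^ 2 / 2 + rowPowerSum α tau 4 / 4 := by
  obtain ⟨h0, h1, h2, -, h4⟩ := dividedDiff_moments (e := m) (v := rowEnd α tau) (Finset.range m)
    (by simp) (rowEnd_strictAnti hα tau).injective.injOn (rowPowerSum α tau) (fun _ => rfl)
    (fun k => ∑ rho, upProb α tau rho * content α tau rho ^ k) (fun k => by
      rw [sum_upProb_mul_content hα tau (· ^ k), Finset.range_add_one])
  simp only [pow_zero, mul_one, pow_one, rowPowerSum_one, rowPowerSum_two] at h0 h1 h2 h4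
  refine ⟨h0, h1, h2.trans (by ring), h4.trans (by ring)⟩

lemma sum_downProb {α : ℝ} (hα : 0 < α) {m : ℕ} (rho : (m + 1).Partition) :
    ∑ tau, downProb α tau rho = 1 := by
  set x := rowEnd α rho with hx
  have hinj : Set.InjOn x (Finset.range (m + 1)) :=
    (rowEnd_strictAnti hα rho).injective.injOn
  have hsum : ∑ tau, downProb α tau rho = -1 / (α * (m + 1)) *
      dividedDiff (Finset.range (m + 1)) (fun i => x i - 1)
        (fun z => ∏ i ∈ Finset.range (m + 2), (z - x i)) := by
    rw [dividedDiff, Finset.mul_sum]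
    refine sum_eq_sum_range_of_rel (fun tau r => AddsBox tau rho r) (fun _ _ h => h.lt)
      (fun _ _ _ h h' => h.row_unique h') (fun _ _ _ h h' => h.tau_unique h') _ _ ?_ ?_ ?_
    · intro tau r h
      exact h.downProb_eq hα
    · intro tau h
      simp [downProb, psi'_eq_zero h]
    · intro r hr h
      have hcorner : rowLen rho (r + 1) = rowLen rho r := by
        by_contra hc
        exact h (exists_addsBox_below rho hc)
      rw [Finset.prod_eq_zero (i := r + 1) (Finset.mem_range.2 (by omega)), zero_div, mul_zero]
      rw [hx, rowEnd, rowEnd, hcorner]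
      push_cast
      ring
  obtain ⟨h0, h1⟩ := dividedDiff_comoments (Finset.range (m + 1)) hinj
  have hsplit : (fun z : ℝ => ∏ i ∈ Finset.range (m + 2), (z - x i)) =
      fun z => z * ∏ i ∈ Finset.range (m + 1), (z - x i) +
        -x (m + 1) * ∏ i ∈ Finset.range (m + 1), (z - x i) := by
    funext z
    rw [Finset.prod_range_succ _ (m + 1)]
    ring
  have hlast : x (m + 1) = -((m : ℝ) + 1) := by
    rw [hx, rowEnd_of_le α rho le_rfl]; push_cast; ring
  have htot := sum_rowEnd α rho
  rw [hsum, hsplit, dividedDiff_add, dividedDiff_const_mul, h0, h1, Finset.sum_sub_distrib, htot,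
    hlast]
  have : (m : ℝ) + 1 ≠ 0 := by positivity
  simp only [Finset.card_range, Finset.sum_const, nsmul_eq_mul, mul_one]
  push_cast
  field_simp
  ring

lemma jackP_nonneg {α : ℝ} (hα : 0 < α) {n : ℕ} (lam : n.Partition) : 0 ≤ jackP α lam := by
  have := cLow_pos hα lam
  have := cUp_pos hα lam
  unfold jackP
  positivity

lemma jackP_mul_upProb {α : ℝ} (hα : 0 < α) {m : ℕ} (tau : m.Partition)
    (rho : (m + 1).Partition) :
    jackP α tau * upProb α tau rho = jackP α rho * downProb α tau rho := by
  have h1 := (cLow_pos hα tau).ne'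
  have h2 := (cUp_pos hα tau).ne'
  have h3 := (cLow_pos hα rho).ne'
  have h4 := (cUp_pos hα rho).ne'
  have h5 : (m : ℝ) + 1 ≠ 0 := by positivity
  rw [jackP, jackP, upProb, downProb, Nat.factorial_succ, pow_succ]
  push_cast
  field_simp

lemma jackP_mul_M {α : ℝ} (hα : 0 < α) {m : ℕ} (lam rho : (m + 1).Partition) :
    jackP α lam * M α lam rho =
      ∑ tau : m.Partition, jackP α tau * upProb α tau lam * upProb α tau rho := by
  have h3 := (cLow_pos hα lam).ne'
  have h4 := (cUp_pos hα lam).ne'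
  have h5 := (cLow_pos hα rho).ne'
  have h6 : (m : ℝ) + 1 ≠ 0 := by positivity
  rw [M, Finset.mul_sum, Finset.mul_sum]
  refine Finset.sum_congr rfl fun tau _ => ?_
  have h1 := (cLow_pos hα (n := m) tau).ne'
  have h2 := (cUp_pos hα (n := m) tau).ne'
  simp only [jackP, upProb, Nat.factorial_succ, pow_succ]
  push_cast
  field_simp

lemma sum_jackP_succ {α : ℝ} (hα : 0 < α) {m : ℕ} (f : (m + 1).Partition → ℝ) :
    ∑ rho, jackP α rho * f rho =
      ∑ tau : m.Partition, jackP α tau * ∑ rho, upProb α tau rho * f rho := by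
  simp only [Finset.mul_sum]
  rw [Finset.sum_comm]
  refine Finset.sum_congr rfl fun rho _ => ?_
  simp only [← mul_assoc, jackP_mul_upProb hα]
  rw [← Finset.sum_mul, ← Finset.mul_sum, sum_downProb hα, mul_one]

lemma sum_jackP {α : ℝ} (hα : 0 < α) (n : ℕ) : ∑ lam : n.Partition, jackP α lam = 1 := by
  induction n with
  | zero => simp [jackP, cLow, cUp, cells]
  | succ m ih =>
    have := sum_jackP_succ hα (m := m) fun _ => 1
    simpa [(upProb_moments hα _).1, ih] using this

lemma sum_jackP_mul_rowPowerSum_four {α : ℝ} (hα : 0 < α) (m : ℕ) :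
    ∑ tau : m.Partition, jackP α tau * rowPowerSum α tau 4 =
      6 * α ^ 2 * m * (m - 1) + (4 * α ^ 3 - 6 * α ^ 2 + 4 * α) * m := by
  induction m with
  | zero => simp [rowPowerSum, rowEnd_of_le]
  | succ m ih =>
    have hup : ∀ tau : m.Partition, ∑ rho, upProb α tau rho * rowPowerSum α rho 4 =
        rowPowerSum α tau 4 + (12 * α ^ 2 * m + (4 * α ^ 3 - 6 * α ^ 2 + 4 * α)) := fun tau => by
      obtain ⟨h0, h1, h2, -⟩ := upProb_moments hα tau
      have : ∀ rho, upProb α tau rho * rowPowerSum α rho 4 =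
          (rowPowerSum α tau 4 + (4 * α ^ 3 - 6 * α ^ 2 + 4 * α)) * upProb α tau rho +
          (12 * α ^ 2 - 12 * α) * (upProb α tau rho * content α tau rho) +
          12 * α * (upProb α tau rho * content α tau rho ^ 2) := fun rho => by
        by_cases h : ∃ r, AddsBox tau rho r
        · obtain ⟨r, hr⟩ := h
          rw [hr.content_eq, hr.rowPowerSum_eq]
          ring
        · simp [upProb, psi'_eq_zero h]
      simp only [this, Finset.sum_add_distrib, ← Finset.mul_sum, h0, h1, h2]
      ring
    rw [sum_jackP_succ hα]
    simp only [hup, mul_add (jackP α _), Finset.sum_add_distrib, ← Finset.sum_mul,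
      sum_jackP hα, ih]
    push_cast
    ring

lemma abs_pow_three_le {s : ℝ} (hs : 0 < s) (c : ℝ) :
    |c| ^ 3 ≤ (2 * s)⁻¹ * c ^ 4 + s / 2 * c ^ 2 := by
  have h : (2 * s)⁻¹ * c ^ 4 + s / 2 * c ^ 2 - |c| ^ 3 = (|c| * (|c| - s)) ^ 2 / (2 * s) := by
    rw [← sq_abs c, show c ^ 4 = |c| ^ 4 by rw [← abs_pow, abs_of_nonneg (by positivity)]]
    field_simp
    ring
  have : 0 ≤ (|c| * (|c| - s)) ^ 2 / (2 * s) := by positivity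
  linarith

lemma abs_sub_pow_three_le (a b : ℝ) : |a - b| ^ 3 ≤ 4 * (|a| ^ 3 + |b| ^ 3) := by
  calc |a - b| ^ 3 ≤ (|a| + |b|) ^ 3 := by gcongr; exact abs_sub a b
    _ ≤ 2 ^ (3 - 1) * (|a| ^ 3 + |b| ^ 3) := add_pow_le (abs_nonneg a) (abs_nonneg b) 3
    _ = 4 * (|a| ^ 3 + |b| ^ 3) := by norm_num

/-- The third absolute moment of the content of the box added to a Jack-distributed partition. -/
lemma sum_abs_content_pow_three_le {α : ℝ} (hα : 1 ≤ α) (m : ℕ) {s : ℝ} (hs : 0 < s)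
    (hsm : s ^ 2 = m + 1) :
    ∑ tau : m.Partition, jackP α tau * ∑ rho, upProb α tau rho * |content α tau rho| ^ 3 ≤
      3 * α ^ 3 * s ^ 3 := by
  have hα0 : 0 < α := by linarith
  have hm : (0 : ℝ) ≤ m := Nat.cast_nonneg m
  calc ∑ tau : m.Partition, jackP α tau * ∑ rho, upProb α tau rho * |content α tau rho| ^ 3
      ≤ ∑ tau : m.Partition, jackP α tau * ((2 * s)⁻¹ *
          (α ^ 2 * m ^ 2 / 2 + rowPowerSum α tau 4 / 4) + s / 2 * (α * m)) := by
        refine Finset.sum_le_sum fun tau _ =>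
          mul_le_mul_of_nonneg_left ?_ (jackP_nonneg hα0 tau)
        obtain ⟨-, -, h2, h4⟩ := upProb_moments hα0 tau
        rw [← h2, ← h4, Finset.mul_sum, Finset.mul_sum, ← Finset.sum_add_distrib]
        refine Finset.sum_le_sum fun rho _ => ?_
        have := mul_le_mul_of_nonneg_left (abs_pow_three_le hs (content α tau rho))
          (upProb_nonneg hα0 tau rho)
        linarith
    _ = ((2 * s)⁻¹ * (α ^ 2 * m ^ 2 / 2) + s / 2 * (α * m)) * ∑ tau : m.Partition, jackP α tau +
          (2 * s)⁻¹ / 4 * ∑ tau : m.Partition, jackP α tau * rowPowerSum α tau 4 := by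
        rw [Finset.mul_sum, Finset.mul_sum, ← Finset.sum_add_distrib]
        exact Finset.sum_congr rfl fun tau _ => by ring
    _ = (2 * s)⁻¹ * (α ^ 2 * m ^ 2 / 2 + (6 * α ^ 2 * m * (m - 1) +
          (4 * α ^ 3 - 6 * α ^ 2 + 4 * α) * m) / 4) + s / 2 * (α * m) := by
        rw [sum_jackP hα0, sum_jackP_mul_rowPowerSum_four hα0]
        ring
    _ ≤ (2 * s)⁻¹ * (4 * α ^ 3 * (s ^ 2) ^ 2) + s / 2 * (α ^ 3 * s ^ 2) := by
        have h13 : α ≤ α ^ 3 := le_self_pow₀ hα (by norm_num)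
        have h23 : α ^ 2 ≤ α ^ 3 := pow_le_pow_right₀ hα (by norm_num)
        have h2 : 0 ≤ α ^ 2 := by positivity
        rw [hsm]
        gcongr
        · have e1 : α ^ 2 * (m : ℝ) ^ 2 ≤ α ^ 3 * (m : ℝ) ^ 2 := by gcongr
          have e2 : α * (m : ℝ) ≤ α ^ 3 * (m : ℝ) := by gcongr
          have e3 : 0 ≤ α ^ 2 * (m : ℝ) := by positivity
          have e4 : 0 ≤ α ^ 3 * (m : ℝ) := by positivity
          have e5 : 0 ≤ α ^ 3 := by positivity
          nlinarith [mul_nonneg e5 (sq_nonneg (m : ℝ))]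
        · linarith
    _ = 5 / 2 * (α ^ 3 * s ^ 3) := by field_simp; ring
    _ ≤ 3 * α ^ 3 * s ^ 3 := by
        have : 0 ≤ α ^ 3 * s ^ 3 := by positivity
        linarith

lemma W_sub_W (α : ℝ) {m : ℕ} (tau : m.Partition) (lam rho : (m + 1).Partition) :
    W α rho - W α lam =
      (content α tau rho - content α tau lam) / Real.sqrt (α * (m + 1).choose 2) := by
  rw [W, W, ← sub_div, content, content]
  congr 1
  ring

lemma half_le_sqrt_mul_choose {α : ℝ} (hα : 1 ≤ α) {n : ℕ} (hn : 2 ≤ n) :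
    (n : ℝ) / 2 ≤ Real.sqrt (α * n.choose 2) := by
  refine Real.le_sqrt_of_sq_le ?_
  have h2 : (2 : ℝ) ≤ n := by exact_mod_cast hn
  have h0 : (0 : ℝ) ≤ n.choose 2 := Nat.cast_nonneg _
  have h1 : (n.choose 2 : ℝ) ≤ α * n.choose 2 := le_mul_of_one_le_left h0 hα
  refine le_trans ?_ h1
  rw [Nat.cast_choose_two]
  nlinarith

lemma sum_jackP_mul_M_le {α : ℝ} (hα : 0 < α) (m : ℕ) {D : ℝ} (hD : 0 < D)
    (hDle : D ≤ Real.sqrt (α * (m + 1).choose 2)) :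
    ∑ lam : (m + 1).Partition, jackP α lam *
        ∑ rho : (m + 1).Partition, M α lam rho * |W α rho - W α lam| ^ 3 ≤
      8 / D ^ 3 * ∑ tau : m.Partition, jackP α tau *
        ∑ rho, upProb α tau rho * |content α tau rho| ^ 3 := by
  have hexp : ∑ lam : (m + 1).Partition, jackP α lam *
        ∑ rho : (m + 1).Partition, M α lam rho * |W α rho - W α lam| ^ 3 =
      ∑ tau : m.Partition, jackP α tau * ∑ lam : (m + 1).Partition, ∑ rho : (m + 1).Partition,
        upProb α tau lam * upProb α tau rho * |W α rho - W α lam| ^ 3 := by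
    simp only [Finset.mul_sum, ← mul_assoc, jackP_mul_M hα, Finset.sum_mul]
    rw [Finset.sum_comm]
    simp only [Finset.sum_comm (γ := m.Partition)]
    rw [Finset.sum_comm]
  rw [hexp, Finset.mul_sum]
  refine Finset.sum_le_sum fun tau _ => ?_
  rw [mul_left_comm]
  refine mul_le_mul_of_nonneg_left ?_ (jackP_nonneg hα tau)
  have hone := (upProb_moments hα tau).1
  calc ∑ lam : (m + 1).Partition, ∑ rho : (m + 1).Partition,
        upProb α tau lam * upProb α tau rho * |W α rho - W α lam| ^ 3
      ≤ ∑ lam : (m + 1).Partition, ∑ rho : (m + 1).Partition, 4 / D ^ 3 *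
        (upProb α tau lam * (upProb α tau rho * |content α tau rho| ^ 3) +
          (upProb α tau lam * |content α tau lam| ^ 3) * upProb α tau rho) := by
        refine Finset.sum_le_sum fun lam _ => Finset.sum_le_sum fun rho _ => ?_
        have hW : |W α rho - W α lam| ^ 3 ≤
            4 * (|content α tau rho| ^ 3 + |content α tau lam| ^ 3) / D ^ 3 := by
          rw [W_sub_W α tau, abs_div, div_pow, abs_of_nonneg (Real.sqrt_nonneg _)]
          gcongr
          exact abs_sub_pow_three_le _ _
        refine (mul_le_mul_of_nonneg_left hW
          (mul_nonneg (upProb_nonneg hα tau lam) (upProb_nonneg hα tau rho))).trans_eq ?_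
        ring
    _ = 8 / D ^ 3 * ∑ rho, upProb α tau rho * |content α tau rho| ^ 3 := by
        simp only [← Finset.mul_sum, Finset.sum_add_distrib, ← Finset.sum_mul, hone]
        ring

/-- Bound on the third Stein error term (Proposition 9 of the paper). -/
theorem stein_third_moment_bound (α : ℝ) (hα : 1 ≤ α) :
    ∃ C : ℝ, ∀ n : ℕ, 2 ≤ n →
      (∑ lam : n.Partition, jackP α lam *
          ∑ rho : n.Partition, M α lam rho * |W α rho - W α lam| ^ 3) ≤
        C * (n : ℝ) ^ (-(3 / 2 : ℝ)) := by
  refine ⟨192 * α ^ 3, fun n hn => ?_⟩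
  obtain ⟨m, rfl⟩ : ∃ m, n = m + 1 := ⟨n - 1, by omega⟩
  have hpos : (0 : ℝ) < ((m + 1 : ℕ) : ℝ) := by positivity
  set s := Real.sqrt ((m + 1 : ℕ) : ℝ) with hs
  have hs0 : 0 < s := Real.sqrt_pos.2 hpos
  have hs2 : s ^ 2 = ((m + 1 : ℕ) : ℝ) := Real.sq_sqrt hpos.le
  have hrpow : ((m + 1 : ℕ) : ℝ) ^ (-(3 / 2 : ℝ)) = (s ^ 3)⁻¹ := by
    rw [Real.rpow_neg hpos.le, hs, Real.sqrt_eq_rpow, ← Real.rpow_natCast, ← Real.rpow_mul hpos.le]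
    norm_num
  calc _ ≤ 8 / (s ^ 2 / 2) ^ 3 * (3 * α ^ 3 * s ^ 3) := by
        refine (sum_jackP_mul_M_le (by linarith) m (D := s ^ 2 / 2) (by positivity)
          (hs2 ▸ half_le_sqrt_mul_choose hα hn)).trans ?_
        gcongr
        exact sum_abs_content_pow_three_le hα m hs0 (by rw [hs2]; push_cast; ring)
    _ = 192 * α ^ 3 * ((m + 1 : ℕ) : ℝ) ^ (-(3 / 2 : ℝ)) := by
        rw [hrpow]
        field_simp
        norm_num

end JackTest
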